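/- arXiv:1508.07657 — 13 statements merged into one kernel-verified Lean document; each statement's English description precedes it below -/
import Mathlib

section
/- Let d ≥ 1, T > 0, K₁ ≥ 0 and K₂ ≠ 0 be real numbers. Let f : [0,T] → ℝ^d be continuous and let R : [0,T] × [0,T] → (ℝ^d →L ℝ^d) be continuous with operator norm bound ‖R(s,t)‖ ≤ K₁·exp(−K₂(s−t)/2) for all 0 ≤ t ≤ s ≤ T. Define g(t) = f(t) − (1/2)·∫_t^T R(s,t) f(s) ds. Then ∫_0^T ‖g(t)‖² dt ≤ ∫_0^T Λ(t,T)·‖f(t)‖² dt. -/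
open Real

/-- The function Λ(t,T) from Theorem 3.1 of the paper. -/
noncomputable def Lam (K₁ K₂ T t : ℝ) : ℝ :=
  1 + (K₁ / K₂) * (1 - Real.exp (-(K₂ * (T - t)) / 2))
    + (K₁ / K₂) * (1 - Real.exp (-(K₂ * t) / 2))
    + (K₁ / K₂) ^ 2 * ((1 - Real.exp (-(K₂ * t) / 2))
        + (1 / 2) * (Real.exp (-(K₂ * (T + t)) / 2) - Real.exp (-(K₂ * (T - t)) / 2)))

/-- Weighted quadratic inequality obtained by integrating `w * (φ - a) ^ 2 ≥ 0`. -/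
lemma two_mul_integral_weight_mul_le {w φ : ℝ → ℝ} {t T : ℝ} (hw : Continuous w)
    (hφ : Continuous φ) (hw0 : ∀ s, 0 ≤ w s) (htT : t ≤ T) (a : ℝ) :
    2 * a * (∫ s in t..T, w s * φ s) ≤
      a ^ 2 * (∫ s in t..T, w s) + ∫ s in t..T, w s * φ s ^ 2 := by
  rw [← intervalIntegral.integral_const_mul, ← intervalIntegral.integral_const_mul,
    ← intervalIntegral.integral_add (Continuous.intervalIntegrable (by fun_prop) _ _)
      (Continuous.intervalIntegrable (by fun_prop) _ _)]
  refine intervalIntegral.integral_mono_on htT (Continuous.intervalIntegrable (by fun_prop) _ _)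
    (Continuous.intervalIntegrable (by fun_prop) _ _) fun s _ => ?_
  nlinarith [mul_nonneg (hw0 s) (sq_nonneg (φ s - a))]

/-- Cauchy–Schwarz inequality for a weighted interval integral. -/
lemma sq_integral_weight_mul_le {w φ : ℝ → ℝ} {t T : ℝ} (hw : Continuous w)
    (hφ : Continuous φ) (hw0 : ∀ s, 0 ≤ w s) (htT : t ≤ T) :
    (∫ s in t..T, w s * φ s) ^ 2 ≤
      (∫ s in t..T, w s) * ∫ s in t..T, w s * φ s ^ 2 := by
  have h := discrim_le_zero (a := ∫ s in t..T, w s) (b := -2 * ∫ s in t..T, w s * φ s)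
    (c := ∫ s in t..T, w s * φ s ^ 2) fun x => by
      linarith [two_mul_integral_weight_mul_le hw hφ hw0 htT x]
  rw [discrim] at h
  linarith

lemma integral_exp_neg_mul_sub_div_two {K : ℝ} (hK : K ≠ 0) (t T : ℝ) :
    ∫ s in t..T, exp (-(K * (s - t)) / 2) = 2 / K * (1 - exp (-(K * (T - t)) / 2)) := by
  have h : ∀ s ∈ Set.uIcc t T, HasDerivAt (fun s => -(2 / K) * exp (-(K * (s - t)) / 2))
      (exp (-(K * (s - t)) / 2)) s := fun s _ => by
    refine ((((((hasDerivAt_id' s).sub_const t).const_mul K).neg).div_const 2).exp.const_mul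
      (-(2 / K))).congr_deriv ?_
    simp only [Pi.neg_apply]
    field_simp
  rw [intervalIntegral.integral_eq_sub_of_hasDerivAt h
    (Continuous.intervalIntegrable (by fun_prop) _ _)]
  simp
  ring

/-- Integration by parts against a tail integral. -/
lemma integral_mul_tail_integral {C c h : ℝ → ℝ} {T : ℝ} (hC : ∀ t, HasDerivAt C (c t) t)
    (hC0 : C 0 = 0) (hc : Continuous c) (hh : Continuous h) :
    ∫ t in (0 : ℝ)..T, c t * ∫ s in t..T, h s = ∫ t in (0 : ℝ)..T, C t * h t := by
  have hJ : ∀ t, HasDerivAt (fun t => ∫ s in t..T, h s) (-h t) t := fun t =>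
    intervalIntegral.integral_hasDerivAt_left (hh.intervalIntegrable _ _)
      (hh.stronglyMeasurableAtFilter _ _) hh.continuousAt
  have hp := intervalIntegral.integral_mul_deriv_eq_deriv_mul (a := 0) (b := T)
    (fun t _ => hC t) (fun t _ => hJ t) (hc.intervalIntegrable _ _)
    (hh.neg.intervalIntegrable _ _)
  simp only [hC0, intervalIntegral.integral_same, mul_zero, zero_mul, sub_zero, zero_sub,
    mul_neg, intervalIntegral.integral_neg] at hp
  linarith

/-- The primitive, vanishing at `0`, of
`t ↦ (K₁ / 2 + K₁² / 4 * ∫ s in t..T, exp (-K₂ (s - t) / 2)) * exp (K₂ t / 2)`. -/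
lemma hasDerivAt_lam_primitive {K₁ K₂ : ℝ} (hK₂ : K₂ ≠ 0) (T t : ℝ) :
    HasDerivAt (fun t => (K₁ / K₂ + (K₁ / K₂) ^ 2) * (exp (K₂ * t / 2) - 1) +
        (K₁ / K₂) ^ 2 * (1 / 2) * (exp (-(K₂ * T) / 2) - exp (-(K₂ * T) / 2) * exp (K₂ * t)))
      ((K₁ / 2 + K₁ ^ 2 / 4 * (2 / K₂ * (1 - exp (-(K₂ * (T - t)) / 2)))) * exp (K₂ * t / 2))
      t := by
  have h1 : HasDerivAt (fun t => exp (K₂ * t / 2)) (exp (K₂ * t / 2) * (K₂ * 1 / 2)) t :=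
    (((hasDerivAt_id t).const_mul K₂).div_const 2).exp
  have h2 : HasDerivAt (fun t => exp (K₂ * t)) (exp (K₂ * t) * (K₂ * 1)) t :=
    ((hasDerivAt_id t).const_mul K₂).exp
  refine (((h1.sub_const 1).const_mul (K₁ / K₂ + (K₁ / K₂) ^ 2)).add
    (((h2.const_mul (exp (-(K₂ * T) / 2))).const_sub (exp (-(K₂ * T) / 2))).const_mul
      ((K₁ / K₂) ^ 2 * (1 / 2)))).congr_deriv ?_
  have e1 : exp (-(K₂ * (T - t)) / 2) = exp (-(K₂ * T) / 2) * exp (K₂ * t / 2) := by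
    rw [← exp_add]; ring_nf
  have e2 : exp (K₂ * t) = exp (K₂ * t / 2) * exp (K₂ * t / 2) := by
    rw [← exp_add]; ring_nf
  rw [e1, e2]
  field_simp
  ring

lemma lam_eq_primitive (K₁ K₂ T t : ℝ) :
    Lam K₁ K₂ T t = 1 + K₁ / 2 * (2 / K₂ * (1 - exp (-(K₂ * (T - t)) / 2))) +
      ((K₁ / K₂ + (K₁ / K₂) ^ 2) * (exp (K₂ * t / 2) - 1) +
        (K₁ / K₂) ^ 2 * (1 / 2) * (exp (-(K₂ * T) / 2) - exp (-(K₂ * T) / 2) * exp (K₂ * t)))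
      * exp (-(K₂ * t) / 2) := by
  have e1 : exp (-(K₂ * (T - t)) / 2) = exp (-(K₂ * T) / 2) * exp (K₂ * t / 2) := by
    rw [← exp_add]; ring_nf
  have e2 : exp (K₂ * t) = exp (K₂ * t / 2) * exp (K₂ * t / 2) := by
    rw [← exp_add]; ring_nf
  have e3 : exp (-(K₂ * (T + t)) / 2) = exp (-(K₂ * T) / 2) * exp (-(K₂ * t) / 2) := by
    rw [← exp_add]; ring_nf
  have e4 : exp (K₂ * t / 2) * exp (-(K₂ * t) / 2) = 1 := by
    rw [← exp_add, ← exp_zero]; ring_nf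
  rw [Lam, e1, e2, e3]
  linear_combination (-(K₁ / K₂ + (K₁ / K₂) ^ 2) +
    (K₁ / K₂) ^ 2 * (1 / 2) * exp (-(K₂ * T) / 2) * exp (K₂ * t / 2)) * e4

theorem damped_gradient_comparison
    (d : ℕ) (hd : 1 ≤ d) (T K₁ K₂ : ℝ) (hT : 0 < T) (hK₁ : 0 ≤ K₁) (hK₂ : K₂ ≠ 0)
    (f : ℝ → EuclideanSpace ℝ (Fin d)) (hf : ContinuousOn f (Set.Icc 0 T))
    (R : ℝ → ℝ → EuclideanSpace ℝ (Fin d) →L[ℝ] EuclideanSpace ℝ (Fin d))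
    (hRcont : ContinuousOn (fun p : ℝ × ℝ => R p.1 p.2) (Set.Icc 0 T ×ˢ Set.Icc 0 T))
    (hR : ∀ t s : ℝ, 0 ≤ t → t ≤ s → s ≤ T →
      ‖R s t‖ ≤ K₁ * Real.exp (-(K₂ * (s - t)) / 2))
    (g : ℝ → EuclideanSpace ℝ (Fin d))
    (hg : ∀ t : ℝ, g t = f t - (1 / 2 : ℝ) • ∫ s in t..T, R s t (f s)) :
    (∫ t in (0:ℝ)..T, ‖g t‖ ^ 2) ≤ ∫ t in (0:ℝ)..T, Lam K₁ K₂ T t * ‖f t‖ ^ 2 := by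
  obtain ⟨φ, hφ, hφf⟩ : ∃ φ : ℝ → ℝ, Continuous φ ∧ ∀ t ∈ Set.Icc 0 T, φ t = ‖f t‖ :=
    ⟨Set.IccExtend hT.le ((Set.Icc 0 T).domRestrict fun t => ‖f t‖),
      hf.norm.domRestrict.Icc_extend', fun t ht => Set.IccExtend_of_mem _ _ ht⟩
  set A : ℝ → ℝ := fun t => 2 / K₂ * (1 - exp (-(K₂ * (T - t)) / 2)) with hA
  have hAc : Continuous A := by fun_prop
  set J : ℝ → ℝ := fun t => ∫ s in t..T, exp (-(K₂ * s) / 2) * φ s ^ 2 with hJ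
  have hhc : Continuous fun s => exp (-(K₂ * s) / 2) * φ s ^ 2 := by fun_prop
  have hJc : Continuous J := by
    have : J = fun t => -∫ s in T..t, exp (-(K₂ * s) / 2) * φ s ^ 2 :=
      funext fun t => intervalIntegral.integral_symm _ _
    rw [this]
    exact (intervalIntegral.continuous_primitive (fun _ _ => hhc.intervalIntegrable _ _) T).neg
  have hpoint : ∀ t ∈ Set.Icc 0 T, ‖g t‖ ^ 2 ≤ (1 + K₁ / 2 * A t) * φ t ^ 2 +
      (K₁ / 2 + K₁ ^ 2 / 4 * A t) * exp (K₂ * t / 2) * J t := by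
    intro t ht
    have hwc : Continuous fun s => exp (-(K₂ * (s - t)) / 2) := by fun_prop
    have hint : ‖∫ s in t..T, R s t (f s)‖ ≤
        K₁ * ∫ s in t..T, exp (-(K₂ * (s - t)) / 2) * φ s := by
      rw [← intervalIntegral.integral_const_mul]
      refine intervalIntegral.norm_integral_le_of_norm_le ht.2
        (Filter.Eventually.of_forall fun s hs => ?_)
        (Continuous.intervalIntegrable (by fun_prop) _ _)
      rw [hφf s ⟨ht.1.trans hs.1.le, hs.2⟩, ← mul_assoc]
      exact (R s t).le_of_opNorm_le (hR t s ht.1 hs.1.le hs.2) _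
    have hH : ∫ s in t..T, exp (-(K₂ * (s - t)) / 2) * φ s ^ 2 = exp (K₂ * t / 2) * J t := by
      rw [hJ, ← intervalIntegral.integral_const_mul]
      refine intervalIntegral.integral_congr fun s _ => ?_
      rw [← mul_assoc, ← exp_add]
      ring_nf
    have hcross := two_mul_integral_weight_mul_le hwc hφ (fun s => (exp_pos _).le) ht.2 (φ t)
    have hcs := sq_integral_weight_mul_le hwc hφ (fun s => (exp_pos _).le) ht.2
    rw [hH, integral_exp_neg_mul_sub_div_two hK₂] at hcross hcs
    change _ ≤ _ * A t + _ at hcross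
    change _ ≤ A t * _ at hcs
    set I := ∫ s in t..T, exp (-(K₂ * (s - t)) / 2) * φ s
    have hgt : ‖g t‖ ≤ φ t + K₁ / 2 * I := by
      rw [hg, hφf t ht]
      refine (norm_sub_le _ _).trans ?_
      rw [norm_smul, Real.norm_of_nonneg (by norm_num : (0 : ℝ) ≤ 1 / 2)]
      linarith
    calc ‖g t‖ ^ 2 ≤ (φ t + K₁ / 2 * I) ^ 2 := by gcongr
      _ = φ t ^ 2 + K₁ / 2 * (2 * φ t * I) + K₁ ^ 2 / 4 * I ^ 2 := by ring
      _ ≤ φ t ^ 2 + K₁ / 2 * (φ t ^ 2 * A t + exp (K₂ * t / 2) * J t) +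
          K₁ ^ 2 / 4 * (A t * (exp (K₂ * t / 2) * J t)) := by gcongr
      _ = _ := by ring
  have hle : (∫ t in (0 : ℝ)..T, ‖g t‖ ^ 2) ≤ ∫ t in (0 : ℝ)..T,
      ((1 + K₁ / 2 * A t) * φ t ^ 2 +
        (K₁ / 2 + K₁ ^ 2 / 4 * A t) * exp (K₂ * t / 2) * J t) := by
    rw [intervalIntegral.integral_of_le hT.le, intervalIntegral.integral_of_le hT.le]
    refine MeasureTheory.integral_mono_of_nonneg (Filter.Eventually.of_forall fun t => sq_nonneg _)
      (Continuous.integrableOn_Ioc (by fun_prop)) ?_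
    filter_upwards [MeasureTheory.ae_restrict_mem measurableSet_Ioc] with t ht
    exact hpoint t ⟨ht.1.le, ht.2⟩
  refine hle.trans_eq ?_
  rw [intervalIntegral.integral_add (Continuous.intervalIntegrable (by fun_prop) _ _)
    (Continuous.intervalIntegrable (by fun_prop) _ _),
    integral_mul_tail_integral (fun t => hasDerivAt_lam_primitive hK₂ T t) (by simp)
      (by fun_prop) hhc,
    ← intervalIntegral.integral_add (Continuous.intervalIntegrable (by fun_prop) _ _)
    (Continuous.intervalIntegrable (by fun_prop) _ _)]
  refine intervalIntegral.integral_congr fun t ht => ?_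
  rw [Set.uIcc_of_le hT.le] at ht
  simp only [lam_eq_primitive, ← hφf t ht, hA]
  ring
end

section
/- Let K₁, K₂ be real numbers with K₂ ≠ 0 and T > 0. Then Λ(T,T) ≥ Λ(0,T). -/
open Real

theorem Lam_endpoint_ge (K₁ K₂ T : ℝ) (hK₂ : K₂ ≠ 0) (hT : 0 < T) :
    Lam K₁ K₂ T 0 ≤ Lam K₁ K₂ T T := by
  have hdiff : Lam K₁ K₂ T T - Lam K₁ K₂ T 0
      = (K₁ / K₂) ^ 2 * (1 / 2 * (1 - Real.exp (-(K₂ * T) / 2)) ^ 2) := by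
    have hsq : Real.exp (-(K₂ * (T + T)) / 2) = Real.exp (-(K₂ * T) / 2) ^ 2 := by
      rw [← Real.exp_nat_mul]
      congr 1
      push_cast
      ring
    simp only [Lam, hsq, sub_self, sub_zero, add_zero, mul_zero, neg_zero, zero_div, Real.exp_zero]
    ring
  exact sub_nonneg.mp (hdiff ▸ by positivity)
end

section
/- Let K₁, K₂ be real numbers with K₂ ≠ 0 and T > 0. Then the derivative of t ↦ Λ(t,T) at t = 0 equals (K₁/2)(K₁+K₂)·(1 − exp(−K₂T/2))/K₂; in particular, if K₁ ≥ 0 and K₁ + K₂ ≥ 0, then this derivative is nonnegative. -/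
open Real

theorem hasDerivAt_Lam_zero (K₁ K₂ T : ℝ) (hK₂ : K₂ ≠ 0) :
    HasDerivAt (fun t => Lam K₁ K₂ T t)
      ((K₁ / 2) * (K₁ + K₂) * (1 - Real.exp (-(K₂ * T) / 2)) / K₂) 0 := by
  have hsub : HasDerivAt (fun t : ℝ => Real.exp (-(K₂ * (T - t)) / 2))
      (Real.exp (-(K₂ * (T - 0)) / 2) * (-(K₂ * -1) / 2)) 0 :=
    ((((hasDerivAt_id' (0 : ℝ)).const_sub T).const_mul K₂).fun_neg.div_const 2).exp
  have hadd : HasDerivAt (fun t : ℝ => Real.exp (-(K₂ * (T + t)) / 2))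
      (Real.exp (-(K₂ * (T + 0)) / 2) * (-(K₂ * 1) / 2)) 0 :=
    ((((hasDerivAt_id' (0 : ℝ)).const_add T).const_mul K₂).fun_neg.div_const 2).exp
  have hid : HasDerivAt (fun t : ℝ => Real.exp (-(K₂ * t) / 2))
      (Real.exp (-(K₂ * 0) / 2) * (-(K₂ * 1) / 2)) 0 :=
    (((hasDerivAt_id' (0 : ℝ)).const_mul K₂).fun_neg.div_const 2).exp
  unfold Lam
  refine (((((hsub.const_sub 1).const_mul (K₁ / K₂)).const_add 1).fun_add
    ((hid.const_sub 1).const_mul (K₁ / K₂))).fun_add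
    (((hid.const_sub 1).fun_add ((hadd.fun_sub hsub).const_mul (1 / 2))).const_mul
      ((K₁ / K₂) ^ 2))).congr_deriv ?_
  simp only [sub_zero, add_zero, mul_zero, neg_zero, zero_div, Real.exp_zero]
  field_simp
  ring

theorem one_sub_exp_neg_mul_div_nonneg (K T : ℝ) (hT : 0 ≤ T) :
    0 ≤ (1 - Real.exp (-(K * T) / 2)) / K := by
  rcases le_total 0 K with hK | hK
  · refine div_nonneg (sub_nonneg.2 (Real.exp_le_one_iff.2 ?_)) hK
    linarith [mul_nonneg hK hT]
  · refine div_nonneg_of_nonpos (sub_nonpos.2 (Real.one_le_exp ?_)) hK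
    linarith [mul_nonpos_of_nonpos_of_nonneg hK hT]

theorem Lam_deriv_at_zero (K₁ K₂ T : ℝ) (hK₂ : K₂ ≠ 0) (hT : 0 < T) :
    deriv (fun t => Lam K₁ K₂ T t) 0
      = (K₁ / 2) * (K₁ + K₂) * (1 - Real.exp (-(K₂ * T) / 2)) / K₂ ∧
    (0 ≤ K₁ → 0 ≤ K₁ + K₂ → 0 ≤ deriv (fun t => Lam K₁ K₂ T t) 0) := by
  have hderiv := (hasDerivAt_Lam_zero K₁ K₂ T hK₂).deriv
  refine ⟨hderiv, fun hK₁ hsum => ?_⟩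
  rw [hderiv, mul_div_assoc]
  exact mul_nonneg (mul_nonneg (by positivity) hsum)
    (one_sub_exp_neg_mul_div_nonneg K₂ T hT.le)
end

section
/- Let K₁, K₂ be real numbers with K₂ ≠ 0 and T > 0. Then the derivative of t ↦ Λ(t,T) at t = T equals −(K₁/2)(1 − exp(−K₂T/2)) − (K₁²/(4K₂))(1 − exp(−K₂T/2))². Moreover, if K₁ > 0, then this derivative is strictly positive when K₂ < 0 and strictly negative when K₂ > 0. -/
open Real

/-- The derivative of `Lam K₁ K₂ T` at an arbitrary point. -/
theorem hasDerivAt_Lam (K₁ K₂ T t : ℝ) :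
    HasDerivAt (Lam K₁ K₂ T)
      ((K₁ / K₂) * -(Real.exp (-(K₂ * (T - t)) / 2) * (K₂ / 2))
        + (K₁ / K₂) * -(Real.exp (-(K₂ * t) / 2) * (-K₂ / 2))
        + (K₁ / K₂) ^ 2 * (-(Real.exp (-(K₂ * t) / 2) * (-K₂ / 2))
          + (1 / 2) * (Real.exp (-(K₂ * (T + t)) / 2) * (-K₂ / 2)
            - Real.exp (-(K₂ * (T - t)) / 2) * (K₂ / 2)))) t := by
  have h_sub : HasDerivAt (fun s => -(K₂ * (T - s)) / 2) (K₂ / 2) t := by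
    simpa using ((((hasDerivAt_id t).const_sub T).const_mul K₂).neg).div_const 2
  have h_id : HasDerivAt (fun s => -(K₂ * s) / 2) (-K₂ / 2) t := by
    simpa using (((hasDerivAt_id t).const_mul K₂).neg).div_const 2
  have h_add : HasDerivAt (fun s => -(K₂ * (T + s)) / 2) (-K₂ / 2) t := by
    simpa using ((((hasDerivAt_id t).const_add T).const_mul K₂).neg).div_const 2
  exact ((((h_sub.exp.const_sub 1).const_mul (K₁ / K₂)).const_add 1).add
    ((h_id.exp.const_sub 1).const_mul (K₁ / K₂))).add
    (((h_id.exp.const_sub 1).add ((h_add.exp.sub h_sub.exp).const_mul (1 / 2))).const_mul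
      ((K₁ / K₂) ^ 2))

theorem Lam_deriv_at_T (K₁ K₂ T : ℝ) (hK₂ : K₂ ≠ 0) (hT : 0 < T) :
    deriv (fun t => Lam K₁ K₂ T t) T
      = -(K₁ / 2) * (1 - Real.exp (-(K₂ * T) / 2))
        - (K₁ ^ 2 / (4 * K₂)) * (1 - Real.exp (-(K₂ * T) / 2)) ^ 2 ∧
    (0 < K₁ →
      (K₂ < 0 → 0 < deriv (fun t => Lam K₁ K₂ T t) T) ∧
      (0 < K₂ → deriv (fun t => Lam K₁ K₂ T t) T < 0)) := by
  have h_deriv : deriv (fun t => Lam K₁ K₂ T t) T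
      = -(K₁ / 2) * (1 - Real.exp (-(K₂ * T) / 2))
        - (K₁ ^ 2 / (4 * K₂)) * (1 - Real.exp (-(K₂ * T) / 2)) ^ 2 := by
    have h_exp : Real.exp (-(K₂ * (T + T)) / 2) = Real.exp (-(K₂ * T) / 2) ^ 2 := by
      rw [sq, ← Real.exp_add]
      ring_nf
    rw [(hasDerivAt_Lam K₁ K₂ T T).deriv, h_exp, sub_self, mul_zero, neg_zero, zero_div,
      Real.exp_zero]
    field_simp
    ring
  refine ⟨h_deriv, fun hK₁ => ⟨fun h_neg => ?_, fun h_pos => ?_⟩⟩ <;> rw [h_deriv]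
  · have h_exp : 1 < Real.exp (-(K₂ * T) / 2) :=
      Real.one_lt_exp_iff.2 (by linarith [mul_neg_of_neg_of_pos h_neg hT])
    have h_lin : 0 < K₁ / 2 * (Real.exp (-(K₂ * T) / 2) - 1) :=
      mul_pos (half_pos hK₁) (sub_pos.2 h_exp)
    have h_quad : K₁ ^ 2 / (4 * K₂) * (1 - Real.exp (-(K₂ * T) / 2)) ^ 2 ≤ 0 :=
      mul_nonpos_of_nonpos_of_nonneg
        (div_nonpos_of_nonneg_of_nonpos (sq_nonneg _) (by linarith)) (sq_nonneg _)
    linarith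
  · have h_exp : Real.exp (-(K₂ * T) / 2) < 1 :=
      Real.exp_lt_one_iff.2 (by linarith [mul_pos h_pos hT])
    have h_lin : 0 < K₁ / 2 * (1 - Real.exp (-(K₂ * T) / 2)) :=
      mul_pos (half_pos hK₁) (sub_pos.2 h_exp)
    have h_quad : 0 ≤ K₁ ^ 2 / (4 * K₂) * (1 - Real.exp (-(K₂ * T) / 2)) ^ 2 := by
      positivity
    linarith
end

section
/- Let K₁, K₂ be real numbers with K₂ < 0, K₁ ≥ 0 and K₁ + K₂ ≥ 0, and let T > 0. Then the function t ↦ Λ(t,T) is strictly increasing on the interval [0,T]. -/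
open Real

/-- With `r = -K₁ / K₂`, `E = exp (-K₂ T / 2)` and `x = exp (-K₂ t / 2)`, the function `Lam` is
a rational function of `x`. -/
lemma Lam_eq_rational (K₁ K₂ T t : ℝ) :
    Lam K₁ K₂ T t = 1 - (-(K₁ / K₂)) * (1 - exp (-K₂ / 2 * T) / exp (-K₂ / 2 * t))
      - (-(K₁ / K₂)) * (1 - exp (-K₂ / 2 * t))
      + (-(K₁ / K₂)) ^ 2 * ((1 - exp (-K₂ / 2 * t))
        + (1 / 2) * (exp (-K₂ / 2 * T) * exp (-K₂ / 2 * t)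
          - exp (-K₂ / 2 * T) / exp (-K₂ / 2 * t))) := by
  have h₁ : exp (-(K₂ * (T - t)) / 2) = exp (-K₂ / 2 * T) / exp (-K₂ / 2 * t) := by
    rw [← exp_sub]; ring_nf
  have h₂ : exp (-(K₂ * (T + t)) / 2) = exp (-K₂ / 2 * T) * exp (-K₂ / 2 * t) := by
    rw [← exp_add]; ring_nf
  have h₃ : exp (-(K₂ * t) / 2) = exp (-K₂ / 2 * t) := by ring_nf
  rw [Lam, h₁, h₂, h₃]
  ring

lemma rational_lt_rational {r E x y : ℝ} (hr : 1 ≤ r) (hx : 1 ≤ x) (hxy : x < y) (hy : y ≤ E) :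
    1 - r * (1 - E / x) - r * (1 - x) + r ^ 2 * ((1 - x) + (1 / 2) * (E * x - E / x)) <
      1 - r * (1 - E / y) - r * (1 - y) + r ^ 2 * ((1 - y) + (1 / 2) * (E * y - E / y)) := by
  have hx₀ : 0 < x := by linarith
  have hy₀ : 0 < y := by linarith
  have hE : 1 < E := by linarith
  have hp : 1 < x * y := by nlinarith
  have hpE : x * y ≤ E ^ 2 := by nlinarith
  have hcoeff : 0 ≤ (E * (x * y) + E - 2 * (x * y)) / 2 := by
    rcases le_total 2 E with h | h
    · nlinarith
    · nlinarith [mul_nonneg (sub_nonneg.2 h) (sub_nonneg.2 hpE),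
        mul_nonneg (by linarith : 0 ≤ E) (sq_nonneg (E - 1))]
  have hbracket : 0 < x * y - E + r * ((E * (x * y) + E - 2 * (x * y)) / 2) := by
    nlinarith [mul_nonneg (sub_nonneg.2 hr) hcoeff,
      mul_pos (by linarith : 0 < E) (sub_pos.2 hp)]
  rw [← sub_pos]
  have hpos : 0 < r * (y - x) / (x * y) *
      (x * y - E + r * ((E * (x * y) + E - 2 * (x * y)) / 2)) :=
    mul_pos (div_pos (mul_pos (by linarith) (sub_pos.2 hxy)) (mul_pos hx₀ hy₀)) hbracket
  convert hpos using 1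
  field_simp
  ring

theorem Lam_strictMonoOn_of_neg (K₁ K₂ T : ℝ)
    (hK₂ : K₂ < 0) (hK₁ : 0 ≤ K₁) (hsum : 0 ≤ K₁ + K₂) (hT : 0 < T) :
    StrictMonoOn (fun t => Lam K₁ K₂ T t) (Set.Icc 0 T) := by
  intro s hs t ht hst
  have ha : 0 < -K₂ / 2 := by linarith
  have hr : 1 ≤ -(K₁ / K₂) := by
    rw [← div_neg, le_div_iff₀ (by linarith)]
    linarith
  simp only [Lam_eq_rational]
  exact rational_lt_rational hr (one_le_exp (mul_nonneg ha.le hs.1))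
    (exp_lt_exp.2 (mul_lt_mul_of_pos_left hst ha))
    (exp_le_exp.2 (mul_le_mul_of_nonneg_left ht.2 ha.le))
end

section
/- Let K₁ > 0, K₂ > 0 and T > 0, and set β = K₁/K₂. Then there exists a unique t₀ ∈ (0,T) at which the function t ↦ Λ(t,T) attains its maximum over [0,T]; moreover t₀ satisfies exp(K₂t₀/2) = √(1 + (β/(2+β))·(1 − exp(−K₂T/2)))·exp(K₂T/4). -/
open Real

/-- `Lam` as a function of `x = exp (K₂ t / 2)` has the form `C - A x - B / x`. -/
lemma Lam_eq (K₁ K₂ T t : ℝ) :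
    Lam K₁ K₂ T t = 1 + 2 * (K₁ / K₂) + (K₁ / K₂) ^ 2
      - (K₁ / K₂ + (K₁ / K₂) ^ 2 / 2) * exp (-(K₂ * T) / 2) * exp (K₂ * t / 2)
      - (K₁ / K₂ + (K₁ / K₂) ^ 2 - (K₁ / K₂) ^ 2 / 2 * exp (-(K₂ * T) / 2))
        / exp (K₂ * t / 2) := by
  have h₁ : exp (-(K₂ * (T - t)) / 2) = exp (-(K₂ * T) / 2) * exp (K₂ * t / 2) := by
    rw [← exp_add]; ring_nf
  have h₂ : exp (-(K₂ * t) / 2) = (exp (K₂ * t / 2))⁻¹ := by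
    rw [← exp_neg]; ring_nf
  have h₃ : exp (-(K₂ * (T + t)) / 2) = exp (-(K₂ * T) / 2) * (exp (K₂ * t / 2))⁻¹ := by
    rw [← h₂, ← exp_add]; ring_nf
  rw [Lam, h₁, h₂, h₃]
  ring

/-- The square of the critical value of `exp (K₂ t / 2)`. -/
lemma sq_sqrt_mul_exp {b : ℝ} (hb : 0 < b) {K₂ T : ℝ} (hE : exp (-(K₂ * T) / 2) < 1) :
    (sqrt (1 + b / (2 + b) * (1 - exp (-(K₂ * T) / 2))) * exp (K₂ * T / 4)) ^ 2
        * exp (-(K₂ * T) / 2)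
      = 1 + b / (2 + b) * (1 - exp (-(K₂ * T) / 2)) := by
  have hpos : 0 ≤ 1 + b / (2 + b) * (1 - exp (-(K₂ * T) / 2)) := by
    have := sub_pos.2 hE
    positivity
  have hexp : exp (K₂ * T / 4) ^ 2 * exp (-(K₂ * T) / 2) = 1 := by
    rw [← exp_nat_mul, ← exp_add, exp_eq_one_iff]
    push_cast
    ring
  rw [mul_pow, sq_sqrt hpos, mul_assoc, hexp, mul_one]

/-- The defect of `Lam` from its value at a critical point is a weighted square. -/
lemma Lam_sub_Lam {K₁ K₂ T t₀ : ℝ} (hb : 0 < K₁ / K₂)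
    (h : exp (K₂ * t₀ / 2) ^ 2 * exp (-(K₂ * T) / 2)
      = 1 + K₁ / K₂ / (2 + K₁ / K₂) * (1 - exp (-(K₂ * T) / 2))) (t : ℝ) :
    Lam K₁ K₂ T t₀ - Lam K₁ K₂ T t
      = (K₁ / K₂ + (K₁ / K₂) ^ 2 / 2) * exp (-(K₂ * T) / 2)
        * (exp (K₂ * t / 2) - exp (K₂ * t₀ / 2)) ^ 2 / exp (K₂ * t / 2) := by
  rw [Lam_eq, Lam_eq]
  have hx := exp_pos (K₂ * t / 2)
  generalize exp (K₂ * t / 2) = x at *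
  generalize exp (K₂ * t₀ / 2) = x₀ at *
  generalize exp (-(K₂ * T) / 2) = E at *
  generalize K₁ / K₂ = b at *
  have hB : b + b ^ 2 - b ^ 2 / 2 * E = (b + b ^ 2 / 2) * E * x₀ ^ 2 := by
    rw [mul_assoc, mul_comm E, h]
    field_simp
    ring
  rw [hB]
  field_simp
  ring

theorem Lam_unique_interior_max (K₁ K₂ T : ℝ)
    (hK₁ : 0 < K₁) (hK₂ : 0 < K₂) (hT : 0 < T) :
    (∃! t₀ : ℝ, t₀ ∈ Set.Ioo 0 T ∧
        ∀ t ∈ Set.Icc 0 T, Lam K₁ K₂ T t ≤ Lam K₁ K₂ T t₀) ∧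
    (∀ t₀ : ℝ, t₀ ∈ Set.Ioo 0 T →
      (∀ t ∈ Set.Icc 0 T, Lam K₁ K₂ T t ≤ Lam K₁ K₂ T t₀) →
      Real.exp (K₂ * t₀ / 2)
        = Real.sqrt (1 + ((K₁ / K₂) / (2 + K₁ / K₂)) * (1 - Real.exp (-(K₂ * T) / 2)))
            * Real.exp (K₂ * T / 4)) := by
  have hb : 0 < K₁ / K₂ := div_pos hK₁ hK₂
  have hE : exp (-(K₂ * T) / 2) < 1 := exp_lt_one_iff.2 (by have := mul_pos hK₂ hT; linarith)
  have hsq := sq_sqrt_mul_exp hb hE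
  have hspos : 0 < sqrt (1 + K₁ / K₂ / (2 + K₁ / K₂) * (1 - exp (-(K₂ * T) / 2)))
      * exp (K₂ * T / 4) := by
    have := sub_pos.2 hE
    positivity
  generalize sqrt (1 + K₁ / K₂ / (2 + K₁ / K₂) * (1 - exp (-(K₂ * T) / 2)))
    * exp (K₂ * T / 4) = s at *
  obtain ⟨t₀, ht₀⟩ : ∃ t₀, exp (K₂ * t₀ / 2) = s :=
    ⟨2 * log s / K₂, by rw [← exp_log hspos, log_exp]; congr 1; field_simp⟩
  have hdiff := Lam_sub_Lam (T := T) hb (ht₀.symm ▸ hsq)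
  have hmax : ∀ t, Lam K₁ K₂ T t ≤ Lam K₁ K₂ T t₀ := fun t => by
    rw [← sub_nonneg, hdiff]
    positivity
  have hinj : ∀ {u v : ℝ}, exp (K₂ * u / 2) < exp (K₂ * v / 2) → u < v := fun h =>
    lt_of_mul_lt_mul_left (by linarith [exp_lt_exp.1 h]) hK₂.le
  have hmem : t₀ ∈ Set.Ioo 0 T := by
    have hE₀ := exp_pos (-(K₂ * T) / 2)
    have hET : exp (-(K₂ * T) / 2) * exp (K₂ * T / 2) = 1 := by
      rw [← exp_add, exp_eq_one_iff]; ring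
    have hq₀ : 0 < K₁ / K₂ / (2 + K₁ / K₂) := by positivity
    have hq₁ : K₁ / K₂ / (2 + K₁ / K₂) < 1 := by
      rw [div_lt_one (by positivity)]; linarith
    constructor <;> apply hinj <;> rw [ht₀]
    · rw [mul_zero, zero_div, exp_zero]
      by_contra! hs
      nlinarith [mul_pos hq₀ (sub_pos.2 hE),
        mul_le_of_le_one_left hE₀.le (pow_le_one₀ hspos.le hs (n := 2))]
    · have hlt : (s * exp (-(K₂ * T) / 2)) ^ 2 < 1 := by
        rw [mul_pow, sq (exp _), ← mul_assoc, hsq]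
        nlinarith [mul_pos (sub_pos.2 hE) hE₀, sq_nonneg (1 - exp (-(K₂ * T) / 2)),
          mul_pos (sub_pos.2 hq₁) (mul_pos (sub_pos.2 hE) hE₀), sq_pos_of_pos (sub_pos.2 hE)]
      have hlt' : s * exp (-(K₂ * T) / 2) < 1 := by nlinarith [mul_pos hspos hE₀]
      rw [← hET, mul_comm] at hlt'
      exact lt_of_mul_lt_mul_left hlt' hE₀.le
  have huniq : ∀ t, t ∈ Set.Ioo 0 T → (∀ u ∈ Set.Icc 0 T, Lam K₁ K₂ T u ≤ Lam K₁ K₂ T t) →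
      exp (K₂ * t / 2) = s := fun t _ h => by
    have hle := sub_nonpos.2 (h t₀ (Set.Ioo_subset_Icc_self hmem))
    rw [hdiff, ht₀] at hle
    by_contra hne
    have := sq_pos_of_ne_zero (sub_ne_zero.2 hne)
    exact hle.not_gt (by positivity)
  refine ⟨⟨t₀, ⟨hmem, fun t _ => hmax t⟩, fun t ⟨ht, h⟩ => ?_⟩, huniq⟩
  have := exp_injective ((huniq t ht h).trans ht₀.symm)
  exact mul_left_cancel₀ hK₂.ne' (by linarith)
end

section
/- Let K₁ > 0, K₂ > 0 and T > 0, and set β = K₁/K₂. Then sup over t ∈ [0,T] of Λ(t,T) equals (1+β)² − (β + β²/2)·√(1 + (β/(2+β))·(1 − exp(−K₂T/2)))·exp(−K₂T/4) − (β + β² − (β²/2)·exp(−K₂T/2))·exp(−K₂T/4) / √(1 + (β/(2+β))·(1 − exp(−K₂T/2))). -/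
open Real

/-- `Lam` in terms of `a = exp (-K₂T/4)` and `y = exp (-K₂t/2)`. -/
lemma Lam_eq_exp (K₁ K₂ T t : ℝ) :
    Lam K₁ K₂ T t = (1 + K₁ / K₂) ^ 2
      - (K₁ / K₂ + (K₁ / K₂) ^ 2 / 2) * (exp (-(K₂ * T) / 4) ^ 2 / exp (-(K₂ * t) / 2))
      - (K₁ / K₂ + (K₁ / K₂) ^ 2 - ((K₁ / K₂) ^ 2 / 2) * exp (-(K₂ * T) / 4) ^ 2)
        * exp (-(K₂ * t) / 2) := by
  have hsub : exp (-(K₂ * (T - t)) / 2) = exp (-(K₂ * T) / 4) ^ 2 / exp (-(K₂ * t) / 2) := by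
    rw [← exp_nat_mul, ← exp_sub]; push_cast; ring_nf
  have hadd : exp (-(K₂ * (T + t)) / 2) = exp (-(K₂ * T) / 4) ^ 2 * exp (-(K₂ * t) / 2) := by
    rw [← exp_nat_mul, ← exp_add]; push_cast; ring_nf
  rw [Lam, hsub, hadd]
  ring

/-- A weighted AM-GM inequality. -/
lemma two_mul_le_sq_div_add_sq_mul (a s : ℝ) {y : ℝ} (hy : 0 < y) :
    2 * a * s ≤ a ^ 2 / y + s ^ 2 * y := by
  have h : a ^ 2 / y + s ^ 2 * y - 2 * a * s = (a - s * y) ^ 2 / y := by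
    field_simp
    ring
  linarith [div_nonneg (sq_nonneg (a - s * y)) hy.le]

theorem Lam_sup_pos_case (K₁ K₂ T : ℝ)
    (hK₁ : 0 < K₁) (hK₂ : 0 < K₂) (hT : 0 < T) :
    sSup ((fun t => Lam K₁ K₂ T t) '' Set.Icc 0 T)
      = (1 + K₁ / K₂) ^ 2
        - (K₁ / K₂ + (K₁ / K₂) ^ 2 / 2)
            * Real.sqrt (1 + ((K₁ / K₂) / (2 + K₁ / K₂)) * (1 - Real.exp (-(K₂ * T) / 2)))
            * Real.exp (-(K₂ * T) / 4)
        - (K₁ / K₂ + (K₁ / K₂) ^ 2 - ((K₁ / K₂) ^ 2 / 2) * Real.exp (-(K₂ * T) / 2))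
            * Real.exp (-(K₂ * T) / 4)
            / Real.sqrt (1 + ((K₁ / K₂) / (2 + K₁ / K₂)) * (1 - Real.exp (-(K₂ * T) / 2))) := by
  have hsq : exp (-(K₂ * T) / 2) = exp (-(K₂ * T) / 4) ^ 2 := by
    rw [← exp_nat_mul]; push_cast; ring_nf
  have hb : 0 < K₁ / K₂ := div_pos hK₁ hK₂
  have ha1 : exp (-(K₂ * T) / 4) < 1 := by
    rw [exp_lt_one_iff]; linarith [mul_pos hK₂ hT]
  have ha0 := exp_pos (-(K₂ * T) / 4)
  have hLam := Lam_eq_exp K₁ K₂ T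
  have hlog : log (exp (-(K₂ * T) / 4)) = -(K₂ * T) / 4 := log_exp _
  rw [hsq]
  generalize K₁ / K₂ = b at *
  generalize exp (-(K₂ * T) / 4) = a at *
  have ha2 : 0 < 1 - a ^ 2 := by nlinarith
  have hc0 : 0 < b / (2 + b) := by positivity
  have hc1 : b / (2 + b) < 1 := by rw [div_lt_one (by linarith)]; linarith
  have harg : 1 ≤ 1 + b / (2 + b) * (1 - a ^ 2) := by linarith [mul_pos hc0 ha2]
  have hs2 := sq_sqrt (zero_le_one.trans harg)
  have hs1 := one_le_sqrt.2 harg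
  set s := √(1 + b / (2 + b) * (1 - a ^ 2))
  have hs0 : 0 < s := by linarith
  have hQ : b + b ^ 2 - b ^ 2 / 2 * a ^ 2 = (b + b ^ 2 / 2) * s ^ 2 := by
    rw [hs2]
    field_simp
    ring
  have hP : 0 < b + b ^ 2 / 2 := by positivity
  have has : a * s ≤ 1 := by
    refine (sq_le_one_iff₀ (by positivity)).1 ?_
    rw [mul_pow, hs2]
    nlinarith [mul_pos hc0 ha2, mul_pos (sub_pos.2 hc1) ha2, mul_pos (mul_pos hc0 ha2) ha2]
  have hval : (1 + b) ^ 2 - (b + b ^ 2 / 2) * s * a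
      - (b + b ^ 2 - b ^ 2 / 2 * a ^ 2) * a / s
      = (1 + b) ^ 2 - (b + b ^ 2 / 2) * (2 * a * s) := by
    rw [hQ]
    field_simp
    ring
  rw [hval]
  refine IsGreatest.csSup_eq ⟨⟨2 / K₂ * (log s - log a), ⟨?_, ?_⟩, ?_⟩, ?_⟩
  · have hla := log_nonpos ha0.le ha1.le
    have hls := log_nonneg hs1
    exact mul_nonneg (by positivity) (by linarith)
  · have hl := log_nonpos (by positivity) has
    rw [log_mul ha0.ne' hs0.ne'] at hl
    rw [div_mul_eq_mul_div, div_le_iff₀ hK₂]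
    linarith
  · have hy : exp (-(K₂ * (2 / K₂ * (log s - log a))) / 2) = a / s := by
      rw [show -(K₂ * (2 / K₂ * (log s - log a))) / 2 = log a - log s by field_simp; ring,
        exp_sub, exp_log ha0, exp_log hs0]
    simp only [hLam, hy, hQ]
    field_simp
    ring
  · rintro _ ⟨t, -, rfl⟩
    simp only [hLam, hQ]
    have h := mul_le_mul_of_nonneg_left
      (two_mul_le_sq_div_add_sq_mul a s (exp_pos (-(K₂ * t) / 2))) hP.le
    linarith
end

section
/- Let K₁, K₂ be real numbers with K₂ < 0, K₁ ≥ 0 and K₁ + K₂ ≥ 0, and let T > 0. Then sup over t ∈ [0,T] of Λ(t,T) equals 1/2 + (1/2)·(1 + (K₁/K₂)·(1 − exp(−K₂T/2)))². -/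
open Real

/-- With `x = exp (-K₂ t / 2)` and `y = exp (-K₂ (T - t) / 2)`, the gap between the values of
`Lam` at the right endpoint and at `t` is
`r (x - 1) (y - 1) + r ^ 2 / 2 * (y - 1) * ((x - 1) ^ 2 + x ^ 2 * (y - 1))` for `r = -K₁ / K₂`. -/
theorem Lam_le_of_nonpos {K₁ K₂ T t : ℝ} (hK₂ : K₂ ≤ 0) (hK₁ : 0 ≤ K₁)
    (ht₀ : 0 ≤ t) (htT : t ≤ T) :
    Lam K₁ K₂ T t
      ≤ 1 / 2 + (1 / 2) * (1 + (K₁ / K₂) * (1 - Real.exp (-(K₂ * T) / 2))) ^ 2 := by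
  have hx : 1 ≤ Real.exp (-(K₂ * t) / 2) := Real.one_le_exp (by nlinarith)
  have hy : 1 ≤ Real.exp (-(K₂ * (T - t)) / 2) := Real.one_le_exp (by nlinarith)
  have hT : Real.exp (-(K₂ * T) / 2)
      = Real.exp (-(K₂ * t) / 2) * Real.exp (-(K₂ * (T - t)) / 2) := by
    rw [← Real.exp_add]; ring_nf
  have hTt : Real.exp (-(K₂ * (T + t)) / 2)
      = Real.exp (-(K₂ * t) / 2) ^ 2 * Real.exp (-(K₂ * (T - t)) / 2) := by
    rw [sq, ← Real.exp_add, ← Real.exp_add]; ring_nf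
  have hr : 0 ≤ -(K₁ / K₂) := neg_nonneg.2 (div_nonpos_of_nonneg_of_nonpos hK₁ hK₂)
  unfold Lam
  rw [hT, hTt]
  generalize Real.exp (-(K₂ * t) / 2) = x at *
  generalize Real.exp (-(K₂ * (T - t)) / 2) = y at *
  generalize K₁ / K₂ = q at *
  have hx' := sub_nonneg.2 hx
  have hy' := sub_nonneg.2 hy
  have h₁ : 0 ≤ -q * (x - 1) * (y - 1) := by positivity
  have h₂ : 0 ≤ q ^ 2 / 2 * (y - 1) * ((x - 1) ^ 2 + x ^ 2 * (y - 1)) := by positivity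
  linear_combination h₁ + h₂

theorem Lam_right_endpoint (K₁ K₂ T : ℝ) :
    Lam K₁ K₂ T T
      = 1 / 2 + (1 / 2) * (1 + (K₁ / K₂) * (1 - Real.exp (-(K₂ * T) / 2))) ^ 2 := by
  have hTT : Real.exp (-(K₂ * (T + T)) / 2) = Real.exp (-(K₂ * T) / 2) ^ 2 := by
    rw [sq, ← Real.exp_add]; ring_nf
  unfold Lam
  rw [hTT, sub_self, mul_zero, neg_zero, zero_div, Real.exp_zero]
  ring

theorem Lam_sup_neg_case (K₁ K₂ T : ℝ)
    (hK₂ : K₂ < 0) (hK₁ : 0 ≤ K₁) (hsum : 0 ≤ K₁ + K₂) (hT : 0 < T) :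
    sSup ((fun t => Lam K₁ K₂ T t) '' Set.Icc 0 T)
      = 1 / 2 + (1 / 2) * (1 + (K₁ / K₂) * (1 - Real.exp (-(K₂ * T) / 2))) ^ 2 := by
  refine IsGreatest.csSup_eq ⟨⟨T, ⟨hT.le, le_rfl⟩, Lam_right_endpoint K₁ K₂ T⟩, ?_⟩
  rintro _ ⟨t, ht, rfl⟩
  exact Lam_le_of_nonpos hK₂.le hK₁ ht.1 ht.2
end

section
/- Let K₁ > 0, K₂ > 0 and T > 0. Then sup over t ∈ [0,T] of Λ(t,T) is at most ψ₊(T,K₁,K₂), i.e. at most (1+β)² − β·√((2+β)(2+2β−β·exp(−K₂T/2)))·exp(−K₂T/4), where β = K₁/K₂. -/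
open Real

/-- ψ₊(T,K₁,K₂), the bound in Theorem 3.5(i) of the paper (case K₂ > 0). -/
noncomputable def psiPlus (T K₁ K₂ : ℝ) : ℝ :=
  (1 + K₁ / K₂) ^ 2
    - (K₁ / K₂) * Real.sqrt ((2 + K₁ / K₂) *
        (2 + 2 * (K₁ / K₂) - (K₁ / K₂) * Real.exp (-(K₂ * T) / 2)))
      * Real.exp (-(K₂ * T) / 4)

/-- A form of the arithmetic-geometric mean inequality with weights `p`, `q`. -/
theorem two_mul_sqrt_mul_le_add {p q a b s : ℝ} (hp : 0 ≤ p) (hq : 0 ≤ q) (ha : 0 ≤ a)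
    (hb : 0 ≤ b) (hs : s ^ 2 = a * b) : 2 * (√(p * q) * s) ≤ p * b + q * a := by
  refine le_of_abs_le (abs_le_of_sq_le_sq ?_ (by positivity))
  have h : (2 * (√(p * q) * s)) ^ 2 = 4 * (p * q * (a * b)) := by
    rw [mul_pow, mul_pow, Real.sq_sqrt (mul_nonneg hp hq), hs]
    ring
  rw [h]
  nlinarith [sq_nonneg (p * b - q * a)]

theorem Lam_le_psiPlus {K₁ K₂ T : ℝ} (hK₁ : 0 ≤ K₁) (hK₂ : 0 ≤ K₂) (hT : 0 ≤ T) (t : ℝ) :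
    Lam K₁ K₂ T t ≤ psiPlus T K₁ K₂ := by
  have hβ : 0 ≤ K₁ / K₂ := div_nonneg hK₁ hK₂
  have hE : Real.exp (-(K₂ * T) / 2) ≤ 1 := by
    rw [Real.exp_le_one_iff]
    have := mul_nonneg hK₂ hT
    linarith
  have hs : Real.exp (-(K₂ * T) / 4) ^ 2
      = Real.exp (-(K₂ * t) / 2) * Real.exp (-(K₂ * (T - t)) / 2) := by
    rw [← Real.exp_nat_mul, ← Real.exp_add]
    congr 1
    push_cast
    ring
  have hTt : Real.exp (-(K₂ * (T + t)) / 2)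
      = Real.exp (-(K₂ * T) / 2) * Real.exp (-(K₂ * t) / 2) := by
    rw [← Real.exp_add]
    congr 1
    ring
  unfold Lam psiPlus
  rw [hTt]
  generalize K₁ / K₂ = β at *
  have hq : 0 ≤ 2 + 2 * β - β * Real.exp (-(K₂ * T) / 2) := by nlinarith
  have key := mul_le_mul_of_nonneg_left
    (two_mul_sqrt_mul_le_add (p := 2 + β) (by linarith) hq (Real.exp_nonneg _)
      (Real.exp_nonneg _) hs) hβ
  linarith

theorem Lam_sup_le_psiPlus (K₁ K₂ T : ℝ)
    (hK₁ : 0 < K₁) (hK₂ : 0 < K₂) (hT : 0 < T) :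
    sSup ((fun t => Lam K₁ K₂ T t) '' Set.Icc 0 T) ≤ psiPlus T K₁ K₂ := by
  refine csSup_le ((Set.nonempty_Icc.mpr hT.le).image _) ?_
  rintro _ ⟨t, -, rfl⟩
  exact Lam_le_psiPlus hK₁.le hK₂.le hT.le t
end

section
/- Fix real numbers K₁ ≥ 0, T > 0 and t ∈ [0,T]. Then Λ(t,T), viewed as a function of K₂ on ℝ \ {0}, tends to 1 + K₁T/2 + K₁²·(Tt/4 − t²/8) as K₂ → 0. -/
open Real Filter

/-- First-order expansion of the exponential at zero, as a difference quotient. -/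
lemma tendsto_exp_mul_sub_one_div (c : ℝ) :
    Tendsto (fun k : ℝ => (Real.exp (c * k) - 1) / k) (nhdsWithin 0 {0}ᶜ) (nhds c) := by
  have h : HasDerivAt (fun k : ℝ => Real.exp (c * k)) c 0 := by
    simpa using ((hasDerivAt_id (0 : ℝ)).const_mul c).exp
  refine h.tendsto_slope.congr fun k => ?_
  simp [slope_def_field]

/-- Second-order expansion of the exponential at zero, as a difference quotient. -/
lemma tendsto_exp_mul_sub_one_sub_div_sq (c : ℝ) :
    Tendsto (fun k : ℝ => (Real.exp (c * k) - 1 - c * k) / k ^ 2) (nhdsWithin 0 {0}ᶜ)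
      (nhds (c ^ 2 / 2)) := by
  have hderiv (k : ℝ) : HasDerivAt (fun k : ℝ => Real.exp (c * k) - 1 - c * k)
      (c * (Real.exp (c * k) - 1)) k := by
    have hlin : HasDerivAt (fun k : ℝ => c * k) c k := by
      simpa using (hasDerivAt_id k).const_mul c
    exact ((hlin.exp.sub_const 1).sub hlin).congr_deriv (by ring)
  have hsq (k : ℝ) : HasDerivAt (fun k : ℝ => k ^ 2) (2 * k) k := by
    simpa using hasDerivAt_pow 2 k
  refine HasDerivAt.lhopital_zero_nhdsNE (Eventually.of_forall hderiv) (Eventually.of_forall hsq)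
    ?_ ?_ ?_ ?_
  · filter_upwards [self_mem_nhdsWithin] with k hk
    simpa using hk
  · simpa using (hderiv 0).continuousAt.tendsto.mono_left nhdsWithin_le_nhds
  · simpa using (hsq 0).continuousAt.tendsto.mono_left nhdsWithin_le_nhds
  · convert (tendsto_exp_mul_sub_one_div c).const_mul (c / 2) using 2
    · ring
    · ring

theorem Lam_tendsto_K₂_zero (K₁ T t : ℝ)
    (hK₁ : 0 ≤ K₁) (hT : 0 < T) (ht : t ∈ Set.Icc 0 T) :
    Filter.Tendsto (fun K₂ => Lam K₁ K₂ T t) (nhdsWithin 0 {0}ᶜ)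
      (nhds (1 + K₁ * T / 2 + K₁ ^ 2 * (T * t / 4 - t ^ 2 / 8))) := by
  have hfirst := ((tendsto_exp_mul_sub_one_div (-(T - t) / 2)).add
    (tendsto_exp_mul_sub_one_div (-t / 2))).const_mul K₁
  have hsecond := ((((tendsto_exp_mul_sub_one_sub_div_sq (-(T + t) / 2)).sub
    (tendsto_exp_mul_sub_one_sub_div_sq (-(T - t) / 2))).const_mul (1 / 2)).sub
    (tendsto_exp_mul_sub_one_sub_div_sq (-t / 2))).const_mul (K₁ ^ 2)
  have hlim := (hfirst.const_sub 1).add hsecond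
  have hval : 1 - K₁ * (-(T - t) / 2 + -t / 2) + K₁ ^ 2 * (1 / 2 * ((-(T + t) / 2) ^ 2 / 2
      - (-(T - t) / 2) ^ 2 / 2) - (-t / 2) ^ 2 / 2)
      = 1 + K₁ * T / 2 + K₁ ^ 2 * (T * t / 4 - t ^ 2 / 8) := by ring
  rw [hval] at hlim
  refine hlim.congr' ?_
  filter_upwards [self_mem_nhdsWithin] with k hk
  have hk0 : k ≠ 0 := hk
  have harg (a : ℝ) : -(k * a) / 2 = -a / 2 * k := by ring
  simp only [Lam, harg]
  generalize Real.exp (-(T - t) / 2 * k) = x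
  generalize Real.exp (-(T + t) / 2 * k) = y
  generalize Real.exp (-t / 2 * k) = z
  field_simp
  ring
end

section
/- Fix real numbers K₁ ≥ 0 and T > 0. Then ψ₊(T,K₁,K₂) tends to 1 + K₁T/2 + K₁²T²/8 as K₂ → 0 from the right (K₂ → 0⁺). -/
open Real Filter

/-- For `K₂ > 0`, rationalizing the numerator of `psiPlus` removes the singularity at `K₂ = 0`,
up to the difference quotient `(1 - exp (-(K₂ * T) / 2)) / K₂`. -/
theorem psiPlus_eq_div {T K₁ K₂ : ℝ} (hK₁ : 0 < K₁) (hT : 0 < T) (hK₂ : 0 < K₂) :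
    psiPlus T K₁ K₂ =
      (2 * (K₂ + K₁) ^ 2 - K₂ ^ 2 + K₁ ^ 2 * (2 * K₂ + K₁) * ((1 - exp (-(K₂ * T) / 2)) / K₂) *
          (2 + K₁ * ((1 - exp (-(K₂ * T) / 2)) / K₂))) /
        ((K₂ + K₁) ^ 2 + K₁ * √((2 * K₂ + K₁) * (2 * K₂ + 2 * K₁ - K₁ * exp (-(K₂ * T) / 2))) *
          exp (-(K₂ * T) / 4)) := by
  have hsq : exp (-(K₂ * T) / 2) = exp (-(K₂ * T) / 4) ^ 2 := by
    rw [← exp_nat_mul]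
    congr 1
    push_cast
    ring
  have hle : exp (-(K₂ * T) / 2) ≤ 1 := exp_le_one_iff.mpr (by nlinarith [mul_pos hK₂ hT])
  have hscale : (2 + K₁ / K₂) * (2 + 2 * (K₁ / K₂) - (K₁ / K₂) * exp (-(K₂ * T) / 2)) =
      (2 * K₂ + K₁) * (2 * K₂ + 2 * K₁ - K₁ * exp (-(K₂ * T) / 2)) / K₂ ^ 2 := by
    field_simp
  have hnonneg : 0 ≤ (2 * K₂ + K₁) * (2 * K₂ + 2 * K₁ - K₁ * exp (-(K₂ * T) / 2)) :=
    mul_nonneg (by positivity) (by nlinarith)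
  rw [psiPlus, hscale, sqrt_div hnonneg, sqrt_sq hK₂.le]
  have hroot := sq_sqrt hnonneg
  have hroot_nonneg := sqrt_nonneg ((2 * K₂ + K₁) * (2 * K₂ + 2 * K₁ - K₁ * exp (-(K₂ * T) / 2)))
  generalize √((2 * K₂ + K₁) * (2 * K₂ + 2 * K₁ - K₁ * exp (-(K₂ * T) / 2))) = r at *
  have he := exp_pos (-(K₂ * T) / 4)
  rw [hsq] at hroot ⊢
  generalize exp (-(K₂ * T) / 4) = e at *
  have hden : 0 < (K₂ + K₁) ^ 2 + K₁ * r * e := by positivity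
  rw [eq_div_iff hden.ne']
  field_simp
  linear_combination (-K₁ ^ 2 * e ^ 2) * hroot

/-- The difference quotient at `0` of `k ↦ 1 - exp (-(k * T) / 2)` tends to `T / 2`. -/
theorem tendsto_one_sub_exp_div (T : ℝ) :
    Tendsto (fun k : ℝ => (1 - exp (-(k * T) / 2)) / k) (nhdsWithin 0 (Set.Ioi 0))
      (nhds (T / 2)) := by
  have hderiv : HasDerivAt (fun k : ℝ => 1 - exp (-(k * T) / 2)) (T / 2) 0 := by
    have h := ((((hasDerivAt_id (0 : ℝ)).mul_const T).neg.div_const 2).exp).const_sub 1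
    refine h.congr_deriv ?_
    simp
    ring
  refine (hderiv.tendsto_slope_zero_right).congr fun k => ?_
  simp [div_eq_inv_mul]

theorem psiPlus_tendsto_K₂_zero (K₁ T : ℝ) (hK₁ : 0 ≤ K₁) (hT : 0 < T) :
    Filter.Tendsto (fun K₂ => psiPlus T K₁ K₂) (nhdsWithin 0 (Set.Ioi 0))
      (nhds (1 + K₁ * T / 2 + K₁ ^ 2 * T ^ 2 / 8)) := by
  rcases hK₁.eq_or_lt with rfl | hpos
  · simp [psiPlus]
  have hquot := tendsto_one_sub_exp_div T
  have hid : Tendsto (fun k : ℝ => k) (nhdsWithin 0 (Set.Ioi 0)) (nhds 0) :=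
    tendsto_nhdsWithin_of_tendsto_nhds tendsto_id
  have hnum : Tendsto (fun k : ℝ => 2 * (k + K₁) ^ 2 - k ^ 2 +
      K₁ ^ 2 * (2 * k + K₁) * ((1 - exp (-(k * T) / 2)) / k) *
        (2 + K₁ * ((1 - exp (-(k * T) / 2)) / k))) (nhdsWithin 0 (Set.Ioi 0))
      (nhds (2 * (0 + K₁) ^ 2 - 0 ^ 2 +
        K₁ ^ 2 * (2 * 0 + K₁) * (T / 2) * (2 + K₁ * (T / 2)))) :=
    ((((hid.add_const K₁).pow 2).const_mul 2).sub (hid.pow 2)).add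
      (((((hid.const_mul 2).add_const K₁).const_mul (K₁ ^ 2)).mul hquot).mul
        ((hquot.const_mul K₁).const_add 2))
  have hden : Tendsto (fun k : ℝ => (k + K₁) ^ 2 +
      K₁ * √((2 * k + K₁) * (2 * k + 2 * K₁ - K₁ * exp (-(k * T) / 2))) * exp (-(k * T) / 4))
      (nhdsWithin 0 (Set.Ioi 0)) (nhds (2 * K₁ ^ 2)) := by
    have hcont : Continuous fun k : ℝ => (k + K₁) ^ 2 +
        K₁ * √((2 * k + K₁) * (2 * k + 2 * K₁ - K₁ * exp (-(k * T) / 2))) *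
          exp (-(k * T) / 4) := by fun_prop
    refine tendsto_nhdsWithin_of_tendsto_nhds (hcont.tendsto' 0 _ ?_)
    have hroot : √(K₁ * (2 * K₁ - K₁)) = K₁ := by
      rw [show K₁ * (2 * K₁ - K₁) = K₁ ^ 2 by ring, sqrt_sq hK₁]
    simp [hroot]
    ring
  have hlim := hnum.div hden (by positivity)
  have hval : (2 * (0 + K₁) ^ 2 - 0 ^ 2 +
      K₁ ^ 2 * (2 * 0 + K₁) * (T / 2) * (2 + K₁ * (T / 2))) / (2 * K₁ ^ 2) =
      1 + K₁ * T / 2 + K₁ ^ 2 * T ^ 2 / 8 := by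
    field_simp
    ring
  rw [hval] at hlim
  refine hlim.congr' ?_
  filter_upwards [self_mem_nhdsWithin] with k hk
  exact (psiPlus_eq_div hpos hT hk).symm
end

section
/- Fix real numbers K₁ ≥ 0 and K₂ > 0. Then, as T → 0 from the right, ψ₊(T,K₁,K₂) = 1 + K₁T/2 + o(T); that is, (ψ₊(T,K₁,K₂) − 1 − K₁T/2)/T tends to 0 as T → 0⁺. -/
open Real Filter

/-- At time zero, `ψ₊` is differentiable with derivative `K₁ / 2`. -/
theorem hasDerivAt_psiPlus_zero {K₁ K₂ : ℝ} (hK₁ : 0 ≤ K₁) (hK₂ : 0 < K₂) :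
    HasDerivAt (fun T => psiPlus T K₁ K₂) (K₁ / 2) 0 := by
  unfold psiPlus
  have hβ : 0 ≤ K₁ / K₂ := by positivity
  have hK : K₁ = K₁ / K₂ * K₂ := by field_simp
  generalize K₁ / K₂ = β at hβ hK ⊢
  subst hK
  have hexp (c : ℝ) :
      HasDerivAt (fun T : ℝ => Real.exp (-(K₂ * T) / c)) (-K₂ / c) 0 := by
    have h := ((((hasDerivAt_id (0 : ℝ)).const_mul K₂).neg).div_const c).exp
    simpa using h
  have hg : HasDerivAt
      (fun T : ℝ => (2 + β) * (2 + 2 * β - β * Real.exp (-(K₂ * T) / 2)))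
      ((2 + β) * (-(β * (-K₂ / 2)))) 0 :=
    (((hexp 2).const_mul β).const_sub (2 + 2 * β)).const_mul (2 + β)
  have hg0 : (2 + β) * (2 + 2 * β - β * Real.exp (-(K₂ * 0) / 2)) = (2 + β) ^ 2 := by
    simp only [mul_zero, neg_zero, zero_div, Real.exp_zero]
    ring
  have hsqrt := hg.sqrt (by rw [hg0]; positivity)
  have h := ((hsqrt.const_mul β).mul (hexp 4)).const_sub ((1 + β) ^ 2)
  refine h.congr_deriv ?_
  rw [hg0, Real.sqrt_sq (by positivity)]
  simp only [mul_zero, neg_zero, zero_div, Real.exp_zero]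
  field_simp
  ring

theorem psiPlus_zero {K₁ K₂ : ℝ} (hK₁ : 0 ≤ K₁) (hK₂ : 0 < K₂) : psiPlus 0 K₁ K₂ = 1 := by
  unfold psiPlus
  have hβ : 0 ≤ K₁ / K₂ := by positivity
  generalize K₁ / K₂ = β at hβ ⊢
  have hsq : (2 + β) * (2 + 2 * β - β * 1) = (2 + β) ^ 2 := by ring
  simp only [mul_zero, neg_zero, zero_div, Real.exp_zero]
  rw [hsq, Real.sqrt_sq (by positivity)]
  ring

theorem psiPlus_small_time (K₁ K₂ : ℝ) (hK₁ : 0 ≤ K₁) (hK₂ : 0 < K₂) :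
    Filter.Tendsto (fun T => (psiPlus T K₁ K₂ - 1 - K₁ * T / 2) / T)
      (nhdsWithin 0 (Set.Ioi 0)) (nhds 0) := by
  have h := (hasDerivAt_psiPlus_zero hK₁ hK₂).tendsto_slope_zero_right.sub_const (K₁ / 2)
  rw [sub_self] at h
  refine h.congr' ?_
  filter_upwards [self_mem_nhdsWithin] with T hT
  have hT0 : T ≠ 0 := ne_of_gt hT
  simp only [zero_add, psiPlus_zero hK₁ hK₂, smul_eq_mul]
  field_simp
end

section
/- Fix real numbers K₁ > 0 and T > 0. Then √((2 + K₁/K₂)·(2 + 2K₁/K₂ − (K₁/K₂)·exp(−K₂T/2))) − 2 − K₁/K₂ tends to K₁T/4 as K₂ → 0 from the right (K₂ → 0⁺). -/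
open Real Filter

/-- The difference of the two factors under the square root tends to `K₁ * T / 2`. -/
lemma tendsto_mul_one_sub_exp_div (K₁ T : ℝ) :
    Tendsto (fun x => K₁ / x * (1 - exp (-(x * T) / 2)))
      (nhdsWithin 0 (Set.Ioi 0)) (nhds (K₁ * T / 2)) := by
  have hderiv : HasDerivAt (fun x : ℝ => exp (-(x * T) / 2)) (-T / 2) 0 := by
    simpa using ((((hasDerivAt_id (0 : ℝ)).mul_const T).neg).div_const 2).exp
  have hslope := (hasDerivWithinAt_iff_tendsto_slope' Set.self_notMem_Ioi).mp
    (hderiv.hasDerivWithinAt (s := Set.Ioi 0))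
  have hmul := hslope.const_mul (-K₁)
  rw [show -K₁ * (-T / 2) = K₁ * T / 2 by ring] at hmul
  refine hmul.congr fun x => ?_
  simp only [slope_def_field, zero_mul, neg_zero, zero_div, exp_zero, sub_zero]
  ring

/-- Rationalized form of `√(a * (a + d)) - a`. -/
lemma sqrt_mul_add_sub_self {a d : ℝ} (ha : 0 < a) (hd : 0 ≤ d) :
    √(a * (a + d)) - a = d / (√(1 + d / a) + 1) := by
  have hr : 0 ≤ 1 + d / a := by positivity
  have hsqrt : √(a * (a + d)) = a * √(1 + d / a) := by
    rw [show a * (a + d) = a ^ 2 * (1 + d / a) by field_simp,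
      sqrt_mul (sq_nonneg a), sqrt_sq ha.le]
  rw [hsqrt, eq_div_iff (by positivity)]
  calc (a * √(1 + d / a) - a) * (√(1 + d / a) + 1)
      = a * (√(1 + d / a) ^ 2 - 1) := by ring
    _ = d := by rw [sq_sqrt hr]; field_simp; ring

theorem sqrt_expansion_K₂_zero (K₁ T : ℝ) (hK₁ : 0 < K₁) (hT : 0 < T) :
    Filter.Tendsto
      (fun K₂ => Real.sqrt ((2 + K₁ / K₂) *
          (2 + 2 * (K₁ / K₂) - (K₁ / K₂) * Real.exp (-(K₂ * T) / 2)))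
        - 2 - K₁ / K₂)
      (nhdsWithin 0 (Set.Ioi 0)) (nhds (K₁ * T / 4)) := by
  have hd := tendsto_mul_one_sub_exp_div K₁ T
  have ha : Tendsto (fun x => 2 + K₁ / x) (nhdsWithin 0 (Set.Ioi 0)) atTop :=
    tendsto_atTop_add_const_left _ _ (tendsto_inv_nhdsGT_zero.const_mul_atTop hK₁)
  have hlim := hd.div (((hd.div_atTop ha).const_add 1).sqrt.add_const 1)
    (by norm_num)
  rw [show K₁ * T / 2 / (√(1 + 0) + 1) = K₁ * T / 4 by norm_num; ring] at hlim
  refine hlim.congr' ?_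
  filter_upwards [self_mem_nhdsWithin] with x (hx : 0 < x)
  have hexp : exp (-(x * T) / 2) ≤ 1 :=
    exp_le_one_iff.mpr (by have := mul_pos hx hT; linarith)
  have hβ : 0 < K₁ / x := by positivity
  rw [sub_sub, show 2 + 2 * (K₁ / x) - K₁ / x * exp (-(x * T) / 2)
    = 2 + K₁ / x + K₁ / x * (1 - exp (-(x * T) / 2)) by ring]
  exact (sqrt_mul_add_sub_self (by positivity)
    (mul_nonneg hβ.le (sub_nonneg.mpr hexp))).symm
end
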